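/- arXiv:1308.4657 — 8 statements merged into one kernel-verified Lean document; each statement's English description precedes it below -/
import Mathlib

section
/- Let d be a soft metric on X with parameter set E and let λ ∈ E. Then a set V ⊆ X is the λ-slice of some soft open set (i.e. there exists a soft open U ⊆ X × E with V = {x ∈ X | (x, λ) ∈ U}) if and only if for every x ∈ V there exists a positive ε : E → ℝ such that {y ∈ X | ∀ e, d (x, λ) (y, λ) e < ε e} ⊆ V. (The topology induced on the λ-th slice by the soft metric topology is the topology generated by the parameterized pseudometrics d (·, λ) (·, λ) e.) -/
/-- A soft metric on `X` with parameter set `E`. -/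
def IsSoftMetric {X E : Type*} (d : X × E → X × E → E → ℝ) : Prop :=
  (∀ p q : X × E, ∀ e : E, 0 ≤ d p q e) ∧
  (∀ p q : X × E, (∀ e : E, d p q e = 0) ↔ p = q) ∧
  (∀ p q : X × E, d p q = d q p) ∧
  (∀ p q r : X × E, ∀ e : E, d p r e ≤ d p q e + d q r e)

/-- The soft open ball of center `p` and radius `ε`. -/
def SoftBall {X E : Type*} (d : X × E → X × E → E → ℝ) (p : X × E) (ε : E → ℝ) :
    Set (X × E) :=
  {q | ∀ e : E, d p q e < ε e}

/-- A set is soft open if every point has a soft ball around it inside the set. -/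
def SoftOpen {X E : Type*} (d : X × E → X × E → E → ℝ) (U : Set (X × E)) : Prop :=
  ∀ p ∈ U, ∃ ε : E → ℝ, (∀ e : E, 0 < ε e) ∧ SoftBall d p ε ⊆ U

/-- A set is soft closed if its complement is soft open. -/
def SoftClosed {X E : Type*} (d : X × E → X × E → E → ℝ) (C : Set (X × E)) : Prop :=
  SoftOpen d Cᶜ

/-- The soft closure of a set: intersection of all soft closed supersets. -/
def SoftClosure {X E : Type*} (d : X × E → X × E → E → ℝ) (S : Set (X × E)) :
    Set (X × E) :=
  ⋂₀ {C | SoftClosed d C ∧ S ⊆ C}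

/-- The soft interior of a set: union of all soft open subsets. -/
def SoftInterior {X E : Type*} (d : X × E → X × E → E → ℝ) (S : Set (X × E)) :
    Set (X × E) :=
  ⋃₀ {U | SoftOpen d U ∧ U ⊆ S}

/-- Soft continuity of `g` at the soft point `p`. -/
def SoftContinuousAt {X E Y E' : Type*} (d : X × E → X × E → E → ℝ)
    (ρ : Y × E' → Y × E' → E' → ℝ) (g : X × E → Y × E') (p : X × E) : Prop :=
  ∀ ε : E' → ℝ, (∀ e' : E', 0 < ε e') → ∃ δ : E → ℝ, (∀ e : E, 0 < δ e) ∧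
    ∀ q : X × E, (∀ e : E, d p q e < δ e) → (∀ e' : E', ρ (g p) (g q) e' < ε e')

/-- Soft convergence of a sequence of soft points. -/
def SoftTendsto {X E : Type*} (d : X × E → X × E → E → ℝ) (s : ℕ → X × E)
    (p : X × E) : Prop :=
  ∀ ε : E → ℝ, (∀ e : E, 0 < ε e) → ∃ N : ℕ, ∀ n ≥ N, ∀ e : E, d (s n) p e < ε e

/-- A soft Cauchy sequence. -/
def SoftCauchy {X E : Type*} (d : X × E → X × E → E → ℝ) (s : ℕ → X × E) : Prop :=
  ∀ ε : E → ℝ, (∀ e : E, 0 < ε e) → ∃ N : ℕ, ∀ m ≥ N, ∀ n ≥ N, ∀ e : E,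
    d (s m) (s n) e < ε e

/-- Completeness of the soft metric space. -/
def SoftComplete {X E : Type*} (d : X × E → X × E → E → ℝ) : Prop :=
  ∀ s : ℕ → X × E, SoftCauchy d s → ∃ p : X × E, SoftTendsto d s p

theorem IsSoftMetric.softOpen_softBall {X E : Type*} {d : X × E → X × E → E → ℝ}
    (hd : IsSoftMetric d) (p : X × E) (ε : E → ℝ) : SoftOpen d (SoftBall d p ε) := by
  intro q hq
  refine ⟨fun e => ε e - d p q e, fun e => sub_pos.2 (hq e), fun r hr e => ?_⟩
  linarith [hd.2.2.2 p q r e, hr e]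

theorem IsSoftMetric.mem_softBall_self {X E : Type*} {d : X × E → X × E → E → ℝ}
    (hd : IsSoftMetric d) (p : X × E) {ε : E → ℝ} (hε : ∀ e : E, 0 < ε e) :
    p ∈ SoftBall d p ε := fun e => by
  rw [(hd.2.1 p p).2 rfl e]
  exact hε e

theorem SoftOpen.sUnion {X E : Type*} {d : X × E → X × E → E → ℝ} {S : Set (Set (X × E))}
    (hS : ∀ U ∈ S, SoftOpen d U) : SoftOpen d (⋃₀ S) := by
  rintro p ⟨U, hU, hp⟩
  obtain ⟨ε, hε, hball⟩ := hS U hU p hp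
  exact ⟨ε, hε, hball.trans (Set.subset_sUnion_of_mem hU)⟩

/-- the slice topology is generated by the parameterized pseudometrics. -/
theorem soft_metric_slice_topology {X E : Type*} [Nonempty X] [Nonempty E]
    (d : X × E → X × E → E → ℝ) (hd : IsSoftMetric d) (lam : E) (V : Set X) :
    (∃ U : Set (X × E), SoftOpen d U ∧ V = {x : X | (x, lam) ∈ U}) ↔
      ∀ x ∈ V, ∃ ε : E → ℝ, (∀ e : E, 0 < ε e) ∧
        {y : X | ∀ e : E, d (x, lam) (y, lam) e < ε e} ⊆ V := by
  constructor
  · rintro ⟨U, hU, rfl⟩ x hx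
    obtain ⟨ε, hε, hball⟩ := hU (x, lam) hx
    exact ⟨ε, hε, fun y hy => hball hy⟩
  · intro h
    refine ⟨SoftInterior d {q | q.2 = lam → q.1 ∈ V}, SoftOpen.sUnion fun U hU => hU.1, ?_⟩
    ext x
    constructor
    · intro hx
      obtain ⟨ε, hε, hball⟩ := h x hx
      refine ⟨SoftBall d (x, lam) ε, ⟨hd.softOpen_softBall _ _, ?_⟩,
        hd.mem_softBall_self _ hε⟩
      rintro ⟨y, _⟩ hy rfl
      exact hball hy
    · rintro ⟨U, ⟨-, hU⟩, hx⟩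
      exact hU hx rfl
end

section
/- (Every soft metric space is soft normal.) Let E be a finite nonempty type and let d be a soft metric on X with parameter set E. If C₁, C₂ ⊆ X × E are soft closed sets with C₁ ∩ C₂ = ∅, then there exist soft open sets U, V ⊆ X × E with C₁ ⊆ U, C₂ ⊆ V and U ∩ V = ∅. -/
/-- The union of the half-radius balls centered at points `p` of `C`, over all radii `r` for which
the ball of radius `r` about `p` misses `D`. -/
def halfBallNhd {X E : Type*} (d : X × E → X × E → E → ℝ) (C D : Set (X × E)) :
    Set (X × E) :=
  {q | ∃ p ∈ C, ∃ r : ℝ, 0 < r ∧ (∀ z ∈ D, ∃ e, r ≤ d p z e) ∧ ∀ e, d p q e < r / 2}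

theorem softOpen_halfBallNhd {X E : Type*} {d : X × E → X × E → E → ℝ} (hd : IsSoftMetric d)
    (C D : Set (X × E)) : SoftOpen d (halfBallNhd d C D) := by
  rintro q ⟨p, hp, r, hr, hD, hq⟩
  refine ⟨fun e => r / 2 - d p q e, fun e => sub_pos.2 (hq e), fun z hz => ?_⟩
  refine ⟨p, hp, r, hr, hD, fun e => ?_⟩
  linarith [hz e, hd.2.2.2 p q z e]

theorem subset_halfBallNhd {X E : Type*} [Finite E] [Nonempty E]
    {d : X × E → X × E → E → ℝ} (hd : IsSoftMetric d) {C D : Set (X × E)}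
    (hD : SoftClosed d D) (hCD : Disjoint C D) : C ⊆ halfBallNhd d C D := by
  intro p hp
  obtain ⟨ε, hε, hball⟩ := hD p (hCD.notMem_of_mem_left hp)
  obtain ⟨e₀, he₀⟩ := Finite.exists_min ε
  refine ⟨p, hp, ε e₀, hε e₀, fun z hz => ?_, fun e => ?_⟩
  · by_contra! h
    exact hball (fun e => (h e).trans_le (he₀ e)) hz
  · rw [(hd.2.1 p p).2 rfl e]
    exact half_pos (hε e₀)

theorem disjoint_halfBallNhd {X E : Type*} {d : X × E → X × E → E → ℝ} (hd : IsSoftMetric d)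
    (C D : Set (X × E)) : Disjoint (halfBallNhd d C D) (halfBallNhd d D C) := by
  refine Set.disjoint_left.2 ?_
  rintro q ⟨p, hp, r, -, hD, hpq⟩ ⟨z, hz, s, -, hC, hzq⟩
  have hpz (e : E) : d p z e < r / 2 + s / 2 := by
    have h := hd.2.2.2 p q z e
    rw [hd.2.2.1 q z] at h
    linarith [hpq e, hzq e]
  obtain ⟨e, he⟩ := hD z hz
  obtain ⟨e', he'⟩ := hC p hp
  rw [hd.2.2.1 z p] at he'
  linarith [hpz e, hpz e']

/-- every soft metric space is soft normal. -/
theorem soft_metric_normal {X E : Type*} [Nonempty X] [Finite E] [Nonempty E]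
    (d : X × E → X × E → E → ℝ) (hd : IsSoftMetric d)
    (C₁ C₂ : Set (X × E)) (h₁ : SoftClosed d C₁) (h₂ : SoftClosed d C₂)
    (hdisj : C₁ ∩ C₂ = ∅) :
    ∃ U V : Set (X × E), SoftOpen d U ∧ SoftOpen d V ∧
      C₁ ⊆ U ∧ C₂ ⊆ V ∧ U ∩ V = ∅ := by
  have hC : Disjoint C₁ C₂ := Set.disjoint_iff_inter_eq_empty.2 hdisj
  exact ⟨halfBallNhd d C₁ C₂, halfBallNhd d C₂ C₁, softOpen_halfBallNhd hd _ _,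
    softOpen_halfBallNhd hd _ _, subset_halfBallNhd hd h₂ hC, subset_halfBallNhd hd h₁ hC.symm,
    (disjoint_halfBallNhd hd _ _).inter_eq⟩
end

section
/- (Soft continuity is equivalent to soft sequential continuity.) Let E be a finite nonempty type, let d be a soft metric on X with parameter set E, ρ a soft metric on Y with parameter set E', and let g : X × E → Y × E' be induced by f : X → Y and φ : E → E'. Then for every soft point p ∈ X × E, g is soft continuous at p if and only if g is soft sequentially continuous at p, i.e. for every sequence of soft points (pₙ) that soft converges to p, the sequence (g pₙ) soft converges to g p. -/
/-- A sequence whose soft distances to `p` are eventually below every positive constant soft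
converges to `p`, when there are only finitely many parameters. -/
theorem softTendsto_of_forall_const {X E : Type*} [Finite E] [Nonempty E]
    {d : X × E → X × E → E → ℝ} {s : ℕ → X × E} {p : X × E}
    (h : ∀ r : ℝ, 0 < r → ∃ N : ℕ, ∀ n ≥ N, ∀ e : E, d (s n) p e < r) :
    SoftTendsto d s p := by
  intro ε hε
  obtain ⟨e₀, he₀⟩ := Finite.exists_min ε
  obtain ⟨N, hN⟩ := h (ε e₀) (hε e₀)
  exact ⟨N, fun n hn e => (hN n hn e).trans_le (he₀ e)⟩

/-- soft continuity is equivalent to soft sequential continuity. -/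
theorem softContinuousAt_iff_seq {X E Y E' : Type*}
    [Nonempty X] [Finite E] [Nonempty E] [Nonempty Y] [Nonempty E']
    (d : X × E → X × E → E → ℝ) (hd : IsSoftMetric d)
    (ρ : Y × E' → Y × E' → E' → ℝ) (hρ : IsSoftMetric ρ)
    (f : X → Y) (φ : E → E') (g : X × E → Y × E')
    (hg : ∀ p : X × E, g p = (f p.1, φ p.2)) (p : X × E) :
    SoftContinuousAt d ρ g p ↔
      ∀ s : ℕ → X × E, SoftTendsto d s p → SoftTendsto ρ (fun n => g (s n)) (g p) := by
  obtain ⟨-, -, hd_symm, -⟩ := hd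
  obtain ⟨-, -, hρ_symm, -⟩ := hρ
  constructor
  · intro hc s hs ε hε
    obtain ⟨δ, hδ, hball⟩ := hc ε hε
    obtain ⟨N, hN⟩ := hs δ hδ
    refine ⟨N, fun n hn e' => ?_⟩
    rw [hρ_symm]
    refine hball (s n) (fun e => ?_) e'
    rw [hd_symm]
    exact hN n hn e
  · intro hseq
    by_contra hc
    unfold SoftContinuousAt at hc
    push Not at hc
    obtain ⟨ε, hε, hbad⟩ := hc
    choose s hs e' he' using fun n : ℕ =>
      hbad (fun _ => 1 / ((n : ℝ) + 1)) fun _ => Nat.one_div_pos_of_nat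
    have hs_tendsto : SoftTendsto d s p := softTendsto_of_forall_const fun r hr => by
      obtain ⟨N, hN⟩ := exists_nat_one_div_lt hr
      refine ⟨N, fun n hn e => ?_⟩
      rw [hd_symm]
      exact (hs n e).trans ((Nat.one_div_le_one_div hn).trans_lt hN)
    obtain ⟨N, hN⟩ := hseq s hs_tendsto ε hε
    have hlt := hN N le_rfl (e' N)
    rw [hρ_symm] at hlt
    exact (he' N).not_gt hlt
end

section
/- Let E be a finite nonempty type, let d be a soft metric on X with parameter set E, and let g : X × E → X × E be a soft contraction with constant α. Then for any soft point p₀, the sequence of Picard iterates defined by pₙ₊₁ = g pₙ is a soft Cauchy sequence. -/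
/-- For a fixed parameter, a soft metric is a pseudometric on the soft points. -/
abbrev IsSoftMetric.pseudoMetricSpace {X E : Type*} {d : X × E → X × E → E → ℝ}
    (hd : IsSoftMetric d) (e : E) : PseudoMetricSpace (X × E) where
  dist p q := d p q e
  dist_self p := (hd.2.1 p p).2 rfl e
  dist_comm p q := congrFun (hd.2.2.1 p q) e
  dist_triangle p q r := hd.2.2.2 p q r e

/-- Over a finite parameter set, being Cauchy for each parameter gives a soft Cauchy sequence. -/
theorem softCauchy_of_forall {X E : Type*} [Finite E] {d : X × E → X × E → E → ℝ}
    {s : ℕ → X × E}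
    (h : ∀ e : E, ∀ ε > 0, ∃ N : ℕ, ∀ m ≥ N, ∀ n ≥ N, d (s m) (s n) e < ε) :
    SoftCauchy d s := by
  intro ε hε
  choose N hN using fun e => h e (ε e) (hε e)
  obtain ⟨M, hM⟩ := Finite.bddAbove_range N
  have hNM (e : E) : N e ≤ M := hM (Set.mem_range_self e)
  exact ⟨M, fun m hm n hn e => hN e m ((hNM e).trans hm) n ((hNM e).trans hn)⟩

/-- Consecutive Picard iterates of a contraction are geometrically close. -/
theorem dist_picard_succ_le {Y : Type*} {δ : Y → Y → ℝ} {g : Y → Y} {a : ℝ} (ha : 0 ≤ a)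
    (hg : ∀ p q, δ (g p) (g q) ≤ a * δ p q) {s : ℕ → Y} (hs : ∀ n, s (n + 1) = g (s n))
    (n : ℕ) : δ (s n) (s (n + 1)) ≤ δ (s 0) (s 1) * a ^ n := by
  induction n with
  | zero => simp
  | succ n ih =>
    calc δ (s (n + 1)) (s (n + 1 + 1)) = δ (g (s n)) (g (s (n + 1))) := by rw [hs (n + 1), hs n]
      _ ≤ a * δ (s n) (s (n + 1)) := hg _ _
      _ ≤ a * (δ (s 0) (s 1) * a ^ n) := by gcongr
      _ = δ (s 0) (s 1) * a ^ (n + 1) := by ring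

/-- Picard iterates of a soft contraction form a soft Cauchy sequence. -/
theorem softContraction_picard_cauchy {X E : Type*} [Nonempty X] [Finite E] [Nonempty E]
    (d : X × E → X × E → E → ℝ) (hd : IsSoftMetric d)
    (f : X → X) (φ : E → E) (g : X × E → X × E)
    (hg : ∀ p : X × E, g p = (f p.1, φ p.2))
    (α : E → ℝ) (hα : ∀ e : E, 0 ≤ α e ∧ α e < 1)
    (hcontr : ∀ p q : X × E, ∀ e : E, d (g p) (g q) e ≤ α e * d p q e)
    (p₀ : X × E) (s : ℕ → X × E) (hs0 : s 0 = p₀)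
    (hs : ∀ n : ℕ, s (n + 1) = g (s n)) :
    SoftCauchy d s := by
  refine softCauchy_of_forall fun e => ?_
  let _ := hd.pseudoMetricSpace e
  have hs' : CauchySeq s :=
    cauchySeq_of_le_geometric (α e) (d (s 0) (s 1) e) (hα e).2
      (dist_picard_succ_le (δ := fun p q => d p q e) (hα e).1 (fun p q => hcontr p q e) hs)
  exact Metric.cauchySeq_iff.1 hs'
end

section
/- (Banach fixed point theorem for soft metric spaces.) Let E be a finite nonempty type, let d be a complete soft metric on X with parameter set E, and let g : X × E → X × E be a soft contraction with constant α. Then there exists a unique soft point p ∈ X × E such that g p = p. -/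
/-- The iterates of a soft contraction form a soft Cauchy sequence. -/
theorem IsSoftMetric.softCauchy_iterate {X E : Type*} [Finite E]
    {d : X × E → X × E → E → ℝ} (hd : IsSoftMetric d) {g : X × E → X × E} {α : E → ℝ}
    (hα : ∀ e, 0 ≤ α e ∧ α e < 1)
    (hcontr : ∀ p q e, d (g p) (g q) e ≤ α e * d p q e) (x : X × E) :
    SoftCauchy d (fun n => g^[n] x) := by
  intro ε hε
  have step : ∀ (e : E) (n : ℕ),
      d (g^[n] x) (g^[n + 1] x) e ≤ d x (g x) e * α e ^ n := by
    intro e n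
    induction n with
    | zero => simp
    | succ n ih =>
      rw [Function.iterate_succ_apply' g (n + 1), Function.iterate_succ_apply' g n]
      rw [Function.iterate_succ_apply' g n] at ih
      calc _ ≤ α e * d (g^[n] x) (g (g^[n] x)) e := hcontr _ _ e
        _ ≤ α e * (d x (g x) e * α e ^ n) := mul_le_mul_of_nonneg_left ih (hα e).1
        _ = _ := by ring
  have cauchy : ∀ e : E, ∃ N, ∀ m ≥ N, ∀ n ≥ N, d (g^[m] x) (g^[n] x) e < ε e := by
    intro e
    let := hd.pseudoMetricSpace e
    have h : CauchySeq (fun n => g^[n] x) :=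
      cauchySeq_of_le_geometric (α e) (d x (g x) e) (hα e).2 (step e)
    exact Metric.cauchySeq_iff.1 h (ε e) (hε e)
  choose N hN using cauchy
  obtain ⟨M, hM⟩ := Finite.exists_le N
  exact ⟨M, fun m hm n hn e => hN e m ((hM e).trans hm) n ((hM e).trans hn)⟩

/-- Banach fixed point theorem for soft metric spaces. -/
theorem soft_banach_fixed_point {X E : Type*} [Nonempty X] [Finite E] [Nonempty E]
    (d : X × E → X × E → E → ℝ) (hd : IsSoftMetric d) (hcomp : SoftComplete d)
    (f : X → X) (φ : E → E) (g : X × E → X × E)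
    (hg : ∀ p : X × E, g p = (f p.1, φ p.2))
    (α : E → ℝ) (hα : ∀ e : E, 0 ≤ α e ∧ α e < 1)
    (hcontr : ∀ p q : X × E, ∀ e : E, d (g p) (g q) e ≤ α e * d p q e) :
    ∃! p : X × E, g p = p := by
  obtain ⟨x₀⟩ := (inferInstance : Nonempty (X × E))
  obtain ⟨p, hp⟩ := hcomp _ (hd.softCauchy_iterate hα hcontr x₀)
  obtain ⟨nonneg, eq_iff, symm, triangle⟩ := hd
  have fixed : g p = p := by
    refine (eq_iff _ _).1 fun e => le_antisymm ?_ (nonneg _ _ e)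
    refine le_of_forall_pos_le_add fun δ hδ => ?_
    obtain ⟨N, hN⟩ := hp (fun _ => δ / 2) fun _ => half_pos hδ
    have hlt := hN N le_rfl e
    have hlt_succ := hN (N + 1) N.le_succ e
    simp only [Function.iterate_succ_apply'] at hlt_succ
    have hle := hcontr p (g^[N] x₀) e
    rw [symm p (g^[N] x₀)] at hle
    have := mul_le_of_le_one_left (nonneg (g^[N] x₀) p e) (hα e).2.le
    linarith [triangle (g p) (g (g^[N] x₀)) p e]
  refine ⟨p, fixed, fun q hq => (eq_iff _ _).1 fun e => ?_⟩
  have hle := hcontr q p e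
  rw [hq, fixed] at hle
  nlinarith [nonneg q p e, hα e]
end

section
/- Let E be a finite nonempty type, let d be a soft metric on X with parameter set E, and let g : X × E → X × E be a soft self-mapping satisfying the Kannan-type soft contractive condition: there is α : E → ℝ with 0 ≤ α e < 1/2 for all e such that d (g p) (g q) e ≤ α e * (d (g p) p e + d (g q) q e) for all soft points p, q and all e. Then for any soft point p₀, the sequence of Picard iterates pₙ₊₁ = g pₙ is a soft Cauchy sequence. -/
open Filter Topology in
/-- A nonnegative sequence with `u (n + 1) ≤ a * (u (n + 1) + u n)` for some `0 ≤ a < 1 / 2`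
tends to zero. -/
theorem tendsto_zero_of_succ_le_mul_add {u : ℕ → ℝ} {a : ℝ} (ha₀ : 0 ≤ a) (ha : a < 1 / 2)
    (hu : ∀ n, 0 ≤ u n) (h : ∀ n, u (n + 1) ≤ a * (u (n + 1) + u n)) :
    Tendsto u atTop (𝓝 0) := by
  have hr₀ : 0 ≤ a / (1 - a) := div_nonneg ha₀ (by linarith)
  have hr : a / (1 - a) < 1 := (div_lt_one (by linarith)).2 (by linarith)
  have hstep (n : ℕ) : u (n + 1) ≤ a / (1 - a) * u n := by
    rw [div_mul_eq_mul_div, le_div_iff₀ (by linarith)]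
    linarith [h n]
  have hpow (n : ℕ) : u n ≤ (a / (1 - a)) ^ n * u 0 := by
    induction n with
    | zero => simp
    | succ n ih =>
      rw [pow_succ', mul_assoc]
      exact (hstep n).trans (mul_le_mul_of_nonneg_left ih hr₀)
  refine squeeze_zero hu hpow ?_
  simpa using (tendsto_pow_atTop_nhds_zero_of_lt_one hr₀ hr).mul_const (u 0)

/-- Picard iterates under the Kannan-type condition form a soft Cauchy sequence. -/
theorem soft_kannan_picard_cauchy {X E : Type*} [Nonempty X] [Finite E] [Nonempty E]
    (d : X × E → X × E → E → ℝ) (hd : IsSoftMetric d)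
    (f : X → X) (φ : E → E) (g : X × E → X × E)
    (hg : ∀ p : X × E, g p = (f p.1, φ p.2))
    (α : E → ℝ) (hα : ∀ e : E, 0 ≤ α e ∧ α e < 1 / 2)
    (hcontr : ∀ p q : X × E, ∀ e : E,
      d (g p) (g q) e ≤ α e * (d (g p) p e + d (g q) q e))
    (p₀ : X × E) (s : ℕ → X × E) (hs0 : s 0 = p₀)
    (hs : ∀ n : ℕ, s (n + 1) = g (s n)) :
    SoftCauchy d s := by
  have hsucc (m n : ℕ) (e : E) : d (s (m + 1)) (s (n + 1)) e ≤
      α e * (d (s (m + 1)) (s m) e + d (s (n + 1)) (s n) e) := by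
    simpa only [hs] using hcontr (s m) (s n) e
  intro ε hε
  have hsmall : ∀ᶠ n in Filter.atTop, ∀ e : E, d (s (n + 1)) (s n) e < ε e :=
    Filter.eventually_all.2 fun e =>
      (tendsto_zero_of_succ_le_mul_add (u := fun n => d (s (n + 1)) (s n) e)
        (hα e).1 (hα e).2 (fun _ => hd.1 _ _ e) (fun n => hsucc (n + 1) n e)).eventually_lt_const
        (hε e)
  obtain ⟨N, hN⟩ := Filter.eventually_atTop.1 hsmall
  refine ⟨N + 1, fun m hm n hn e => ?_⟩
  obtain ⟨m, rfl⟩ := Nat.exists_eq_add_of_le' (Nat.one_le_of_lt hm)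
  obtain ⟨n, rfl⟩ := Nat.exists_eq_add_of_le' (Nat.one_le_of_lt hn)
  have hm' := hN m (by omega) e
  have hn' := hN n (by omega) e
  have hnonneg := add_nonneg (hd.1 (s (m + 1)) (s m) e) (hd.1 (s (n + 1)) (s n) e)
  linarith [hsucc m n e, mul_le_mul_of_nonneg_right (hα e).2.le hnonneg]
end

section
/- (Kannan-type fixed point theorem for soft metric spaces.) Let E be a finite nonempty type, let d be a complete soft metric on X with parameter set E, and let g : X × E → X × E be a soft self-mapping for which there exists α : E → ℝ with 0 ≤ α e < 1/2 for all e such that d (g p) (g q) e ≤ α e * (d (g p) p e + d (g q) q e) for all soft points p, q and all e ∈ E. Then there exists a unique soft point p ∈ X × E such that g p = p. -/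
/-- Along the orbit of a soft Kannan contraction, the distances between consecutive terms
tend to zero. -/
theorem tendsto_dist_iterate_of_kannan {X E : Type*} {d : X × E → X × E → E → ℝ}
    (hd : IsSoftMetric d) {g : X × E → X × E} {e : E} {a : ℝ} (ha₀ : 0 ≤ a) (ha : a < 1 / 2)
    (hcontr : ∀ p q : X × E, d (g p) (g q) e ≤ a * (d (g p) p e + d (g q) q e)) (p : X × E) :
    Filter.Tendsto (fun n => d (g^[n + 1] p) (g^[n] p) e) Filter.atTop (nhds 0) := by
  have h1a : 0 < 1 - a := by linarith
  have hc₀ : 0 ≤ a / (1 - a) := div_nonneg ha₀ h1a.le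
  have hc₁ : a / (1 - a) < 1 := by rw [div_lt_one h1a]; linarith
  have hbound : ∀ n, d (g^[n + 1] p) (g^[n] p) e ≤ (a / (1 - a)) ^ n * d (g p) p e := by
    intro n
    induction n with
    | zero => simp
    | succ n ih =>
      have h := hcontr (g^[n + 1] p) (g^[n] p)
      simp only [← Function.iterate_succ_apply' g] at h
      have hstep : d (g^[n + 1 + 1] p) (g^[n + 1] p) e
          ≤ a / (1 - a) * d (g^[n + 1] p) (g^[n] p) e := by
        rw [div_mul_eq_mul_div, le_div_iff₀ h1a]
        linarith
      calc d (g^[n + 1 + 1] p) (g^[n + 1] p) e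
          ≤ a / (1 - a) * d (g^[n + 1] p) (g^[n] p) e := hstep
        _ ≤ a / (1 - a) * ((a / (1 - a)) ^ n * d (g p) p e) :=
          mul_le_mul_of_nonneg_left ih hc₀
        _ = (a / (1 - a)) ^ (n + 1) * d (g p) p e := by ring
  refine squeeze_zero (fun n => hd.1 _ _ e) hbound ?_
  simpa using (tendsto_pow_atTop_nhds_zero_of_lt_one hc₀ hc₁).mul_const (d (g p) p e)

/-- Kannan-type fixed point theorem for soft metric spaces. -/
theorem soft_kannan_fixed_point {X E : Type*} [Nonempty X] [Finite E] [Nonempty E]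
    (d : X × E → X × E → E → ℝ) (hd : IsSoftMetric d) (hcomp : SoftComplete d)
    (f : X → X) (φ : E → E) (g : X × E → X × E)
    (hg : ∀ p : X × E, g p = (f p.1, φ p.2))
    (α : E → ℝ) (hα : ∀ e : E, 0 ≤ α e ∧ α e < 1 / 2)
    (hcontr : ∀ p q : X × E, ∀ e : E,
      d (g p) (g q) e ≤ α e * (d (g p) p e + d (g q) q e)) :
    ∃! p : X × E, g p = p := by
  have hdist := fun p e => tendsto_dist_iterate_of_kannan hd (hα e).1 (hα e).2
    (fun p q => hcontr p q e) p
  obtain ⟨hnonneg, heq, hsymm, htri⟩ := hd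
  obtain ⟨p₀⟩ : Nonempty (X × E) := inferInstance
  have hcauchy : SoftCauchy d (fun n => g^[n + 1] p₀) := by
    intro ε hε
    obtain ⟨N, hN⟩ := Filter.eventually_atTop.1
      (Filter.eventually_all.2 fun e => (hdist p₀ e).eventually_lt_const (hε e))
    refine ⟨N, fun m hm n hn e => ?_⟩
    have h := hcontr (g^[m] p₀) (g^[n] p₀) e
    simp only [← Function.iterate_succ_apply' g] at h
    have hm' := hN m hm e
    have hn' := hN n hn e
    have hm₀ := hnonneg (g^[m + 1] p₀) (g^[m] p₀) e
    have hn₀ := hnonneg (g^[n + 1] p₀) (g^[n] p₀) e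
    have hhalf := mul_le_mul_of_nonneg_right (hα e).2.le (add_nonneg hm₀ hn₀)
    dsimp only
    linarith
  obtain ⟨p, hp⟩ := hcomp _ hcauchy
  have hfix : g p = p := by
    refine (heq _ _).1 fun e => le_antisymm ?_ (hnonneg _ _ e)
    have hle : d (g p) p e ≤ 0 + 1 / 2 * d (g p) p e := by
      refine le_of_forall_pos_le_add fun δ hδ => ?_
      obtain ⟨N, hN⟩ := hp (fun _ => δ / 2) fun _ => half_pos hδ
      obtain ⟨n, hn, hnN⟩ := (((hdist p₀ e).eventually_lt_const hδ).and
        (Filter.eventually_ge_atTop N)).exists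
      have hconv := hN n hnN e
      have h := hcontr p (g^[n] p₀) e
      simp only [← Function.iterate_succ_apply' g] at h
      have hhalf := mul_le_mul_of_nonneg_right (hα e).2.le
        (add_nonneg (hnonneg (g p) p e) (hnonneg (g^[n + 1] p₀) (g^[n] p₀) e))
      have ht := htri (g p) (g^[n + 1] p₀) p e
      dsimp only at hconv
      linarith
    linarith
  refine ⟨p, hfix, fun q hq => (heq _ _).1 fun e => ?_⟩
  have hself : ∀ r : X × E, d r r e = 0 := fun r => (heq r r).2 rfl e
  have h := hcontr q p e
  rw [hq, hfix, hself, hself, add_zero, mul_zero] at h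
  exact le_antisymm h (hnonneg _ _ e)
end

section
/- (Chatterjea-type fixed point theorem for soft metric spaces.) Let E be a finite nonempty type, let d be a complete soft metric on X with parameter set E, and let g : X × E → X × E be a soft self-mapping for which there exists α : E → ℝ with 0 ≤ α e < 1/2 for all e such that d (g p) (g q) e ≤ α e * (d (g p) q e + d (g q) p e) for all soft points p, q and all e ∈ E. Then there exists a unique soft point p ∈ X × E such that g p = p. -/
open Filter Topology

theorem SoftTendsto.tendsto {X E : Type*} {d : X × E → X × E → E → ℝ} (hd : IsSoftMetric d)
    {s : ℕ → X × E} {p : X × E} (h : SoftTendsto d s p) (e : E) :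
    Tendsto (fun n => d (s n) p e) atTop (𝓝 0) := by
  rw [Metric.tendsto_atTop]
  intro ε hε
  obtain ⟨N, hN⟩ := h (fun _ => ε) (fun _ => hε)
  refine ⟨N, fun n hn => ?_⟩
  rw [Real.dist_0_eq_abs, abs_of_nonneg (hd.1 _ _ e)]
  exact hN n hn e

/-- A sequence whose mutual distances are controlled by a null sequence is soft Cauchy. -/
theorem SoftCauchy.of_le_add {X E : Type*} [Finite E] {d : X × E → X × E → E → ℝ}
    {s : ℕ → X × E} {b : ℕ → E → ℝ} (hb : ∀ e, Tendsto (fun n => b n e) atTop (𝓝 0))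
    (h : ∀ m n e, d (s m) (s n) e ≤ b m e + b n e) : SoftCauchy d s := by
  intro ε hε
  have hsmall : ∀ᶠ n in atTop, ∀ e, b n e < ε e / 2 :=
    eventually_all.2 fun e => (hb e).eventually_lt_const (half_pos (hε e))
  obtain ⟨N, hN⟩ := eventually_atTop.1 hsmall
  exact ⟨N, fun m hm n hn e => by linarith [h m n e, hN m hm e, hN n hn e]⟩

section Chatterjea

variable {X E : Type*} {d : X × E → X × E → E → ℝ} {g : X × E → X × E} {α : E → ℝ}

theorem IsSoftMetric.self_eq_zero (hd : IsSoftMetric d) (p : X × E) (e : E) : d p p e = 0 :=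
  (hd.2.1 p p).2 rfl e

/-- Under a Chatterjea condition, the distance of two images is controlled by the displacements
of the two points. -/
theorem IsSoftMetric.chatterjea_dist_map_le (hd : IsSoftMetric d)
    (hα : ∀ e, 0 ≤ α e ∧ α e < 1 / 2)
    (hcontr : ∀ p q e, d (g p) (g q) e ≤ α e * (d (g p) q e + d (g q) p e))
    (p q : X × E) (e : E) :
    d (g p) (g q) e ≤ α e / (1 - 2 * α e) * (d p (g p) e + d q (g q) e) := by
  obtain ⟨h0, h1⟩ := hα e
  have hq : d (g p) q e ≤ d (g p) (g q) e + d q (g q) e := by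
    simpa only [hd.2.2.1 q (g q)] using hd.2.2.2 (g p) (g q) q e
  have hp : d (g q) p e ≤ d (g p) (g q) e + d p (g p) e := by
    simpa only [hd.2.2.1 p (g p), hd.2.2.1 (g p) (g q)] using hd.2.2.2 (g q) (g p) p e
  have hsum := mul_le_mul_of_nonneg_left (add_le_add hq hp) h0
  rw [div_mul_eq_mul_div, le_div_iff₀ (by linarith)]
  linarith [hcontr p q e]

/-- A Chatterjea map contracts displacements. -/
theorem IsSoftMetric.chatterjea_displacement_le (hd : IsSoftMetric d)
    (hα : ∀ e, 0 ≤ α e ∧ α e < 1 / 2)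
    (hcontr : ∀ p q e, d (g p) (g q) e ≤ α e * (d (g p) q e + d (g q) p e))
    (p : X × E) (e : E) :
    d (g p) (g (g p)) e ≤ α e / (1 - α e) * d p (g p) e := by
  obtain ⟨h0, h1⟩ := hα e
  have htri : d (g (g p)) p e ≤ d p (g p) e + d (g p) (g (g p)) e := by
    simpa only [hd.2.2.1 p (g (g p))] using hd.2.2.2 p (g p) (g (g p)) e
  have hc := hcontr p (g p) e
  rw [hd.self_eq_zero, zero_add] at hc
  have hmul := mul_le_mul_of_nonneg_left htri h0
  rw [div_mul_eq_mul_div, le_div_iff₀ (by linarith)]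
  linarith

/-- The displacements along an orbit of a Chatterjea map tend to zero. -/
theorem IsSoftMetric.chatterjea_tendsto_displacement (hd : IsSoftMetric d)
    (hα : ∀ e, 0 ≤ α e ∧ α e < 1 / 2)
    (hcontr : ∀ p q e, d (g p) (g q) e ≤ α e * (d (g p) q e + d (g q) p e))
    (p : X × E) (e : E) :
    Tendsto (fun n => d (g^[n] p) (g (g^[n] p)) e) atTop (𝓝 0) := by
  obtain ⟨h0, h1⟩ := hα e
  have hk0 : 0 ≤ α e / (1 - α e) := div_nonneg h0 (by linarith)
  have hk1 : α e / (1 - α e) < 1 := by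
    rw [div_lt_one (by linarith)]
    linarith
  have hbound (n : ℕ) :
      d (g^[n] p) (g (g^[n] p)) e ≤ (α e / (1 - α e)) ^ n * d p (g p) e := by
    induction n with
    | zero => simp
    | succ n ih =>
      rw [Function.iterate_succ_apply', pow_succ', mul_assoc]
      exact (hd.chatterjea_displacement_le hα hcontr _ e).trans
        (mul_le_mul_of_nonneg_left ih hk0)
  refine squeeze_zero (fun n => hd.1 _ _ e) hbound ?_
  simpa using (tendsto_pow_atTop_nhds_zero_of_lt_one hk0 hk1).mul_const (d p (g p) e)

/-- The orbits of a Chatterjea map are soft Cauchy. -/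
theorem IsSoftMetric.chatterjea_softCauchy [Finite E] (hd : IsSoftMetric d)
    (hα : ∀ e, 0 ≤ α e ∧ α e < 1 / 2)
    (hcontr : ∀ p q e, d (g p) (g q) e ≤ α e * (d (g p) q e + d (g q) p e)) (p : X × E) :
    SoftCauchy d fun n => g^[n] (g p) := by
  refine SoftCauchy.of_le_add
    (b := fun n e => α e / (1 - 2 * α e) * d (g^[n] p) (g (g^[n] p)) e) (fun e => ?_)
    fun m n e => ?_
  · simpa using (hd.chatterjea_tendsto_displacement hα hcontr p e).const_mul _
  · simp only [← Function.iterate_succ_apply, Function.iterate_succ_apply', ← mul_add]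
    exact hd.chatterjea_dist_map_le hα hcontr _ _ e

/-- The limit of an orbit of a Chatterjea map is a fixed point. -/
theorem IsSoftMetric.chatterjea_map_eq_of_softTendsto (hd : IsSoftMetric d)
    (hα : ∀ e, 0 ≤ α e ∧ α e < 1 / 2)
    (hcontr : ∀ p q e, d (g p) (g q) e ≤ α e * (d (g p) q e + d (g q) p e))
    {p q : X × E} (h : SoftTendsto d (fun n => g^[n] q) p) : g p = p := by
  refine (hd.2.1 _ _).1 fun e => le_antisymm ?_ (hd.1 _ _ e)
  obtain ⟨h0, h1⟩ := hα e
  have hlim := h.tendsto hd e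
  have hlim_succ := (tendsto_add_atTop_iff_nat 1).2 hlim
  have hbound (n : ℕ) : (1 - α e) * d (g p) p e ≤
      α e * d (g^[n] q) p e + (1 + α e) * d (g^[n + 1] q) p e := by
    rw [Function.iterate_succ_apply']
    have htri := hd.2.2.2 (g p) (g (g^[n] q)) p e
    have htri' := hd.2.2.2 (g p) p (g^[n] q) e
    rw [hd.2.2.1 p] at htri'
    have hmul := mul_le_mul_of_nonneg_left htri' h0
    linarith [hcontr p (g^[n] q) e]
  have hle : (1 - α e) * d (g p) p e ≤ 0 := by
    refine ge_of_tendsto' (x := atTop) ?_ hbound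
    simpa using (hlim.const_mul (α e)).add (hlim_succ.const_mul (1 + α e))
  exact nonpos_of_mul_nonpos_right hle (by linarith)

/-- A Chatterjea map has at most one fixed point. -/
theorem IsSoftMetric.chatterjea_fixedPoint_unique (hd : IsSoftMetric d)
    (hα : ∀ e, 0 ≤ α e ∧ α e < 1 / 2)
    (hcontr : ∀ p q e, d (g p) (g q) e ≤ α e * (d (g p) q e + d (g q) p e))
    {p q : X × E} (hp : g p = p) (hq : g q = q) : p = q := by
  refine (hd.2.1 _ _).1 fun e => le_antisymm ?_ (hd.1 _ _ e)
  have h := hd.chatterjea_dist_map_le hα hcontr p q e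
  rwa [hp, hq, hd.self_eq_zero, hd.self_eq_zero, add_zero, mul_zero] at h

end Chatterjea

/-- Chatterjea-type fixed point theorem for soft metric spaces. -/
theorem soft_chatterjea_fixed_point {X E : Type*} [Nonempty X] [Finite E] [Nonempty E]
    (d : X × E → X × E → E → ℝ) (hd : IsSoftMetric d) (hcomp : SoftComplete d)
    (f : X → X) (φ : E → E) (g : X × E → X × E)
    (hg : ∀ p : X × E, g p = (f p.1, φ p.2))
    (α : E → ℝ) (hα : ∀ e : E, 0 ≤ α e ∧ α e < 1 / 2)
    (hcontr : ∀ p q : X × E, ∀ e : E,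
      d (g p) (g q) e ≤ α e * (d (g p) q e + d (g q) p e)) :
    ∃! p : X × E, g p = p := by
  obtain ⟨p₀⟩ := (inferInstance : Nonempty (X × E))
  obtain ⟨p, hp⟩ := hcomp _ (hd.chatterjea_softCauchy hα hcontr p₀)
  have hfix := hd.chatterjea_map_eq_of_softTendsto hα hcontr hp
  exact ⟨p, hfix, fun q hq => hd.chatterjea_fixedPoint_unique hα hcontr hq hfix⟩
end
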